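/- For a positive integer N, an anchor a ∈ ℤ³, and a permutation σ of {0, 1, 2}, define the Kuhn tetrahedron T_N(a, σ) = {x ∈ ℝ³ : 1 ≥ (Nx − a)_{σ(0)} ≥ (Nx − a)_{σ(1)} ≥ (Nx − a)_{σ(2)} ≥ 0}. Then for all positive integers N and k, every Kuhn tetrahedron at resolution kN is contained in some Kuhn tetrahedron at resolution N: for every a′ ∈ ℤ³ and permutation σ′ there exist a ∈ ℤ³ and a permutation σ with T_{kN}(a′, σ′) ⊆ T_N(a, σ). Consequently, when the ratio between consecutive grid resolutions is an integer ≥ 2, the finer tetrahedral grid refines the coarser one, so every polyhedral cell of the multi-resolution tetrahedral grid equals a tetrahedron at the finest level. -/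

import Mathlib

/-- The Kuhn tetrahedron at resolution `N` with anchor `a ∈ ℤ³` and coordinate
permutation `σ`: the set `{x ∈ ℝ³ : 1 ≥ (Nx − a)_{σ(0)} ≥ (Nx − a)_{σ(1)} ≥ (Nx − a)_{σ(2)} ≥ 0}`. -/
def kuhnTet (N : ℕ) (a : Fin 3 → ℤ) (σ : Equiv.Perm (Fin 3)) : Set (Fin 3 → ℝ) :=
  {x | ((N : ℝ) * x (σ 0) - (a (σ 0) : ℝ)) ≤ 1 ∧
       ((N : ℝ) * x (σ 1) - (a (σ 1) : ℝ)) ≤ ((N : ℝ) * x (σ 0) - (a (σ 0) : ℝ)) ∧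
       ((N : ℝ) * x (σ 2) - (a (σ 2) : ℝ)) ≤ ((N : ℝ) * x (σ 1) - (a (σ 1) : ℝ)) ∧
       0 ≤ ((N : ℝ) * x (σ 2) - (a (σ 2) : ℝ))}

/-- Adding numbers in `[0, 1]` that decrease along the indices to integers preserves the weakly
decreasing order of the integers, provided that ties are ordered by index. -/
theorem add_le_add_of_lex {n : ℕ} {s : Fin n → ℤ} {z : Fin n → ℝ} (hz : Antitone z)
    (h0 : ∀ i, 0 ≤ z i) (h1 : ∀ i, z i ≤ 1) {i j : Fin n} (hs : s j ≤ s i)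
    (hij : s i = s j → i < j) : (s j : ℝ) + z j ≤ s i + z i := by
  rcases hs.eq_or_lt with h | h
  · rw [h]
    linarith [hz (hij h.symm).le]
  · have h' : (s j : ℝ) + 1 ≤ s i := by exact_mod_cast h
    linarith [h0 i, h1 j]

/-- Every Kuhn tetrahedron at resolution `k·N` is contained in some Kuhn tetrahedron at
resolution `N`: the finer Kuhn tetrahedral grid refines the coarser one. -/
theorem kuhn_grid_refines (N k : ℕ) (hN : 0 < N) (hk : 0 < k) :
    ∀ (a' : Fin 3 → ℤ) (σ' : Equiv.Perm (Fin 3)),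
      ∃ (a : Fin 3 → ℤ) (σ : Equiv.Perm (Fin 3)),
        kuhnTet (k * N) a' σ' ⊆ kuhnTet N a σ := by
  intro a' σ'
  have hkZ : (0 : ℤ) < k := by exact_mod_cast hk
  have hkR : (0 : ℝ) < k := by exact_mod_cast hk
  let s : Fin 3 → ℤ := fun j => a' (σ' j) % k
  let τ := Tuple.sort fun j => -s j
  obtain ⟨hmono, hties⟩ := Tuple.eq_sort_iff.1 (rfl : τ = Tuple.sort fun j => -s j)
  refine ⟨fun i => a' i / k, τ.trans σ', ?_⟩
  rintro x ⟨hx0, hx1, hx2, hx3⟩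
  let z : Fin 3 → ℝ := fun j => ((k * N : ℕ) : ℝ) * x (σ' j) - a' (σ' j)
  have hz : Antitone z := by
    rw [Fin.antitone_iff_succ_le]
    intro i
    fin_cases i
    exacts [hx1, hx2]
  have h0 : ∀ i, 0 ≤ z i := fun i => hx3.trans (hz (Fin.le_last i))
  have h1 : ∀ i, z i ≤ 1 := fun i => (hz (Fin.zero_le i)).trans hx0
  have hw : ∀ i, (k : ℝ) * (N * x (σ' i) - ((a' (σ' i) / k : ℤ) : ℝ)) = s i + z i := by
    intro i
    have h : ((a' (σ' i) % k : ℤ) : ℝ) + k * ((a' (σ' i) / k : ℤ) : ℝ) = a' (σ' i) := by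
      exact_mod_cast Int.emod_add_mul_ediv (a' (σ' i)) k
    simp only [s, z]
    push_cast
    linear_combination -h
  have hstep : ∀ i j, i < j → (N : ℝ) * x (σ' (τ j)) - ((a' (σ' (τ j)) / k : ℤ) : ℝ) ≤
      N * x (σ' (τ i)) - ((a' (σ' (τ i)) / k : ℤ) : ℝ) := by
    intro i j hij
    refine le_of_mul_le_mul_left ?_ hkR
    rw [hw, hw]
    exact add_le_add_of_lex hz h0 h1 (neg_le_neg_iff.1 (hmono hij.le))
      fun h => hties i j hij (congrArg Neg.neg h)
  refine ⟨?_, hstep 0 1 (by decide), hstep 1 2 (by decide), ?_⟩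
  · refine le_of_mul_le_mul_left ?_ hkR
    have h : (s (τ 0) : ℝ) + 1 ≤ k := by exact_mod_cast Int.emod_lt_of_pos (a' (σ' (τ 0))) hkZ
    have hle := h1 (τ 0)
    refine (hw (τ 0)).trans_le ?_
    linarith
  · refine nonneg_of_mul_nonneg_right ?_ hkR
    have h : (0 : ℝ) ≤ s (τ 2) := by exact_mod_cast Int.emod_nonneg (a' (σ' (τ 2))) hkZ.ne'
    exact (add_nonneg h (h0 (τ 2))).trans_eq (hw (τ 2)).symm
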